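/- arXiv:2307.13571 — 3 statements merged into one kernel-verified Lean document; each statement's English description precedes it below -/
import Mathlib

section
/- Let x_1,…,x_M, y_1,…,y_N be points in ℝ^d, f_1,…,f_M, g_1,…,g_N vectors in ℝ^k, p ≥ 1, β > 0, λ > 0. Then the minimization of Σ_{i,j} ((1/β)‖x_i−y_j‖^p + ‖f_i−g_j‖^p) γ_{ij} + λ(M + N − 2Σ_{i,j} γ_{ij}) over matrices γ ∈ ℝ_{≥0}^{M×N} whose row sums and column sums are each at most 1 admits a minimizer γ all of whose entries lie in {0,1} and such that every row and every column of γ contains at most one nonzero entry (i.e. γ is induced by a partial one-to-one matching). -/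
open MeasureTheory Filter Topology BoundedContinuousFunction
open scoped ENNReal

noncomputable section

/-- `PiLe μ ν` is the set `Π≤(μ,ν)` of partial transport plans: positive measures on the
product whose marginals are setwise dominated by `μ` and `ν` respectively. -/
def PiLe {X : Type*} [MeasurableSpace X] (μ ν : Measure X) : Set (Measure (X × X)) :=
  {γ | γ.map Prod.fst ≤ μ ∧ γ.map Prod.snd ≤ ν}

/-- The objective of the optimal partial transport problem with ground cost `c` and
mass creation/destruction penalty `lam`:
`∫ c dγ + lam (μ(X) + ν(X) − 2 γ(X×X))`. -/
def optObj {X : Type*} [MeasurableSpace X] (c : X × X → ℝ) (lam : ℝ) (μ ν : Measure X)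
    (γ : Measure (X × X)) : ℝ :=
  (∫ z, c z ∂γ) + lam * ((μ Set.univ).toReal + (ν Set.univ).toReal - 2 * (γ Set.univ).toReal)

/-- The optimal partial transport cost `OPT_{c,lam}(μ,ν)`. -/
def OPTc {X : Type*} [MeasurableSpace X] (c : X × X → ℝ) (lam : ℝ) (μ ν : Measure X) : ℝ :=
  sInf (optObj c lam μ ν '' PiLe μ ν)

/-- The ground cost of the `PTL^p` problem:
`(1/β) ‖x − y‖^p + ‖f(x) − g(y)‖^p`. -/
def ptlpCost {d k : ℕ} (Ω : Set (EuclideanSpace ℝ (Fin d))) (p β : ℝ)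
    (f g : Ω → EuclideanSpace ℝ (Fin k)) : (Ω × Ω) → ℝ :=
  fun z => (1 / β) * ‖(z.1 : EuclideanSpace ℝ (Fin d)) - (z.2 : EuclideanSpace ℝ (Fin d))‖ ^ p
    + ‖f z.1 - g z.2‖ ^ p

/-- The (p-th power of the) partial transport `L^p` distance `PTL^p_{β,lam}((f,μ),(g,ν))`. -/
def PTLp {d k : ℕ} (Ω : Set (EuclideanSpace ℝ (Fin d))) (p β lam : ℝ)
    (f : Ω → EuclideanSpace ℝ (Fin k)) (μ : Measure Ω)
    (g : Ω → EuclideanSpace ℝ (Fin k)) (ν : Measure Ω) : ℝ :=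
  OPTc (ptlpCost Ω p β f g) lam μ ν

/-- Total variation norm `‖μ − ν‖_TV` of the difference of two finite measures. -/
def tvDist {X : Type*} [MeasurableSpace X] (μ ν : Measure X)
    [IsFiniteMeasure μ] [IsFiniteMeasure ν] : ℝ :=
  ((μ.toSignedMeasure - ν.toSignedMeasure).totalVariation Set.univ).toReal

/-- A nonnegative matrix with row and column sums at most one is the upper right block of a
doubly stochastic matrix. -/
theorem fromBlocks_diagonal_mem_doublyStochastic {m n : Type*} [Fintype m] [Fintype n]
    [DecidableEq m] [DecidableEq n] (γ : Matrix m n ℝ) (h0 : ∀ i j, 0 ≤ γ i j)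
    (hr : ∀ i, ∑ j, γ i j ≤ 1) (hc : ∀ j, ∑ i, γ i j ≤ 1) :
    Matrix.fromBlocks (Matrix.diagonal fun i => 1 - ∑ j, γ i j) γ γ.transpose
      (Matrix.diagonal fun j => 1 - ∑ i, γ i j) ∈ doublyStochastic ℝ (m ⊕ n) := by
  rw [mem_doublyStochastic_iff_sum]
  refine ⟨?_, ?_, ?_⟩
  · rintro (i | i) (j | j)
    · by_cases h : i = j
      · subst h
        simpa using hr i
      · simp [h]
    · exact h0 i j
    · exact h0 j i
    · by_cases h : i = j
      · subst h
        simpa using hc i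
      · simp [h]
  · rintro (i | i) <;> simp [Fintype.sum_sum_type, Matrix.diagonal_apply]
  · rintro (i | i) <;> simp [Fintype.sum_sum_type, Matrix.diagonal_apply]

/-- Over nonnegative matrices with row and column sums at most one, every linear functional is
minimized at a block of a permutation matrix. -/
theorem exists_perm_forall_sum_mul_le {m n : Type*} [Fintype m] [Fintype n]
    [DecidableEq m] [DecidableEq n] (w : m → n → ℝ) :
    ∃ σ : Equiv.Perm (m ⊕ n), ∀ γ : Matrix m n ℝ, (∀ i j, 0 ≤ γ i j) →
      (∀ i, ∑ j, γ i j ≤ 1) → (∀ j, ∑ i, γ i j ≤ 1) →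
      ∑ i, ∑ j, w i j * σ.permMatrix ℝ (Sum.inl i) (Sum.inr j) ≤ ∑ i, ∑ j, w i j * γ i j := by
  obtain ⟨σ, hσ⟩ := Finite.exists_min fun τ : Equiv.Perm (m ⊕ n) =>
    ∑ i, ∑ j, w i j * τ.permMatrix ℝ (Sum.inl i) (Sum.inr j)
  refine ⟨σ, fun γ h0 hr hc => ?_⟩
  obtain ⟨a, ha0, ha1, ha⟩ := exists_eq_sum_perm_of_mem_doublyStochastic
    (fromBlocks_diagonal_mem_doublyStochastic γ h0 hr hc)
  have hγ : ∀ i j, γ i j = ∑ τ, a τ * τ.permMatrix ℝ (Sum.inl i) (Sum.inr j) := fun i j => by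
    simpa [Matrix.sum_apply] using (congrFun (congrFun ha (Sum.inl i)) (Sum.inr j)).symm
  calc ∑ i, ∑ j, w i j * σ.permMatrix ℝ (Sum.inl i) (Sum.inr j)
      = ∑ τ, a τ * ∑ i, ∑ j, w i j * σ.permMatrix ℝ (Sum.inl i) (Sum.inr j) := by
        rw [← Finset.sum_mul, ha1, one_mul]
    _ ≤ ∑ τ, a τ * ∑ i, ∑ j, w i j * τ.permMatrix ℝ (Sum.inl i) (Sum.inr j) :=
        Finset.sum_le_sum fun τ _ => mul_le_mul_of_nonneg_left (hσ τ) (ha0 τ)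
    _ = ∑ i, ∑ j, w i j * γ i j := by
        simp_rw [hγ, Finset.mul_sum]
        rw [Finset.sum_comm]
        refine Finset.sum_congr rfl fun i _ => ?_
        rw [Finset.sum_comm]
        exact Finset.sum_congr rfl fun j _ => Finset.sum_congr rfl fun τ _ => by ring

/-- the empirical `PTL^p` problem admits a minimizer induced by a
partial one-to-one matching (a `{0,1}`-valued matrix with at most one nonzero
entry in each row and column). -/
theorem empirical_ptlp_exists_matching_minimizer {d k : ℕ} (M N : ℕ)
    (x : Fin M → EuclideanSpace ℝ (Fin d)) (y : Fin N → EuclideanSpace ℝ (Fin d))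
    (f : Fin M → EuclideanSpace ℝ (Fin k)) (g : Fin N → EuclideanSpace ℝ (Fin k))
    (p β lam : ℝ) (hp : 1 ≤ p) (hβ : 0 < β) (hlam : 0 < lam) :
    ∃ γ : Matrix (Fin M) (Fin N) ℝ,
      ((∀ i j, 0 ≤ γ i j) ∧ (∀ i, ∑ j, γ i j ≤ 1) ∧ (∀ j, ∑ i, γ i j ≤ 1)) ∧
      (∀ i j, γ i j = 0 ∨ γ i j = 1) ∧
      (∀ i j j', γ i j ≠ 0 → γ i j' ≠ 0 → j = j') ∧
      (∀ i i' j, γ i j ≠ 0 → γ i' j ≠ 0 → i = i') ∧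
      ∀ γ' : Matrix (Fin M) (Fin N) ℝ,
        (∀ i j, 0 ≤ γ' i j) → (∀ i, ∑ j, γ' i j ≤ 1) → (∀ j, ∑ i, γ' i j ≤ 1) →
        ((∑ i, ∑ j, ((1 / β) * ‖x i - y j‖ ^ p + ‖f i - g j‖ ^ p) * γ i j)
            + lam * ((M : ℝ) + (N : ℝ) - 2 * ∑ i, ∑ j, γ i j))
          ≤ ((∑ i, ∑ j, ((1 / β) * ‖x i - y j‖ ^ p + ‖f i - g j‖ ^ p) * γ' i j)
            + lam * ((M : ℝ) + (N : ℝ) - 2 * ∑ i, ∑ j, γ' i j)) := by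
  obtain ⟨σ, hσ⟩ := exists_perm_forall_sum_mul_le fun i j =>
    (1 / β) * ‖x i - y j‖ ^ p + ‖f i - g j‖ ^ p - 2 * lam
  have hentry : ∀ i j, σ.permMatrix ℝ (Sum.inl i) (Sum.inr j) =
      if σ (Sum.inl i) = Sum.inr j then 1 else 0 := fun i j => by
    simp [Equiv.Perm.permMatrix, PEquiv.toMatrix_apply, eq_comm]
  have hP : σ.permMatrix ℝ ∈ doublyStochastic ℝ (Fin M ⊕ Fin N) := permMatrix_mem_doublyStochastic
  refine ⟨fun i j => σ.permMatrix ℝ (Sum.inl i) (Sum.inr j), ⟨?_, ?_, ?_⟩, ?_, ?_, ?_, ?_⟩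
  · exact fun i j => nonneg_of_mem_doublyStochastic hP
  · intro i
    rw [← sum_row_of_mem_doublyStochastic hP (Sum.inl i), Fintype.sum_sum_type]
    exact le_add_of_nonneg_left (Finset.sum_nonneg fun j _ => nonneg_of_mem_doublyStochastic hP)
  · intro j
    rw [← sum_col_of_mem_doublyStochastic hP (Sum.inr j), Fintype.sum_sum_type]
    exact le_add_of_nonneg_right (Finset.sum_nonneg fun i _ => nonneg_of_mem_doublyStochastic hP)
  · intro i j
    simp only [hentry]
    split_ifs <;> simp
  · intro i j j' h h'
    simp only [hentry, ne_eq, ite_eq_right_iff, one_ne_zero, imp_false, not_not] at h h'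
    exact Sum.inr_injective (h.symm.trans h')
  · intro i i' j h h'
    simp only [hentry, ne_eq, ite_eq_right_iff, one_ne_zero, imp_false, not_not] at h h'
    exact Sum.inl_injective (σ.injective (h.trans h'.symm))
  · intro γ h0 hr hc
    have h := hσ γ h0 hr hc
    simp only [sub_mul, Finset.sum_sub_distrib, mul_assoc, ← Finset.mul_sum] at h
    beta_reduce
    linarith
end
end

section
/- Let Ω be a nonempty closed subset of ℝ^d, λ > 0, μ, ν finite positive Radon measures on Ω, and f, g : Ω → ℝ^k measurable. Then the infimum over positive measures μ₀ ≤ μ∧ν of ∫_Ω min(‖f(x)−g(x)‖^p, 2λ) dμ₀(x) + λ(μ(Ω) + ν(Ω) − 2μ₀(Ω)) is attained at μ₀ = μ∧ν, and its value equals ∫_Ω min(‖f(x)−g(x)‖^p, 2λ) d(μ∧ν)(x) + λ‖μ−ν‖_TV. -/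
open MeasureTheory Filter Topology BoundedContinuousFunction
open scoped ENNReal

noncomputable section

namespace MeasureTheory

variable {X : Type*} [MeasurableSpace X] {μ ν : Measure X} [IsFiniteMeasure μ] [IsFiniteMeasure ν]

theorem Measure.le_sub_add : μ ≤ μ - ν + ν := by
  obtain ⟨s, hs⟩ := exists_isHahnDecomposition μ ν
  have on_s : μ.restrict s ≤ (μ - ν + ν).restrict s := by
    rw [Measure.restrict_add]
    exact hs.le_on.trans (Measure.le_add_left le_rfl)
  have on_compl : μ.restrict sᶜ ≤ (μ - ν + ν).restrict sᶜ := by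
    rw [Measure.restrict_add, Measure.restrict_sub_eq_restrict_sub_restrict hs.measurableSet.compl,
      Measure.sub_add_cancel_of_le hs.ge_on_compl]
  calc μ = μ.restrict s + μ.restrict sᶜ :=
        (Measure.restrict_add_restrict_compl hs.measurableSet).symm
    _ ≤ (μ - ν + ν).restrict s + (μ - ν + ν).restrict sᶜ := add_le_add on_s on_compl
    _ = μ - ν + ν := Measure.restrict_add_restrict_compl hs.measurableSet

theorem Measure.sub_add_inf : μ - ν + μ ⊓ ν = μ := by
  have : IsFiniteMeasure (μ ⊓ ν) := isFiniteMeasure_of_le μ inf_le_left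
  have h_sub : μ - ν ≤ μ - μ ⊓ ν := Measure.sub_le_of_le_add <|
    calc μ = μ - μ ⊓ ν + μ ⊓ ν := (Measure.sub_add_cancel_of_le inf_le_left).symm
      _ ≤ μ - μ ⊓ ν + ν := by gcongr; exact inf_le_right
  refine le_antisymm ?_ ?_
  · calc μ - ν + μ ⊓ ν ≤ μ - μ ⊓ ν + μ ⊓ ν := by gcongr
      _ = μ := Measure.sub_add_cancel_of_le inf_le_left
  · have h_inf : μ - (μ - ν) ≤ μ ⊓ ν := le_inf Measure.sub_le <|
      (Measure.sub_le_iff_le_add_of_le Measure.sub_le).2 <| by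
        rw [add_comm]; exact Measure.le_sub_add
    rw [add_comm]
    exact (Measure.sub_le_iff_le_add_of_le Measure.sub_le).1 h_inf

/-- `‖μ - ν‖_TV = μ(X) + ν(X) - 2 (μ ⊓ ν)(X)`. -/
theorem tvDist_eq_sub_two_mul_inf :
    tvDist μ ν = (μ Set.univ).toReal + (ν Set.univ).toReal
      - 2 * ((μ ⊓ ν) Set.univ).toReal := by
  have : IsFiniteMeasure (μ ⊓ ν) := isFiniteMeasure_of_le μ inf_le_left
  have hμ : (μ - ν).real Set.univ + (μ ⊓ ν).real Set.univ = μ.real Set.univ := by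
    rw [← measureReal_add_apply, Measure.sub_add_inf]
  have hν : (ν - μ).real Set.univ + (μ ⊓ ν).real Set.univ = ν.real Set.univ := by
    rw [← measureReal_add_apply, inf_comm, Measure.sub_add_inf]
  have htv : tvDist μ ν = (μ - ν).real Set.univ + (ν - μ).real Set.univ := by
    rw [tvDist, SignedMeasure.totalVariation, Measure.toJordanDecomposition_toSignedMeasure_sub,
      Measure.jordanDecompositionOfToSignedMeasureSub_posPart,
      Measure.jordanDecompositionOfToSignedMeasureSub_negPart, ← measureReal_add_apply,
      measureReal_def]
  simp only [← measureReal_def]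
  linarith

theorem integral_sub_mul_measureReal_univ_anti {h : X → ℝ} {C : ℝ} (hν : Integrable h ν)
    (hC : ∀ x, h x ≤ C) (hle : μ ≤ ν) :
    ∫ x, h x ∂ν - C * ν.real Set.univ ≤ ∫ x, h x ∂μ - C * μ.real Set.univ := by
  have hdiff : ∫ x, h x ∂(ν - μ) ≤ C * (ν - μ).real Set.univ :=
    calc ∫ x, h x ∂(ν - μ) ≤ ∫ _, C ∂(ν - μ) :=
          integral_mono (hν.mono_measure Measure.sub_le) (integrable_const C) hC
      _ = C * (ν - μ).real Set.univ := by simp [mul_comm]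
  have hint : ∫ x, h x ∂ν = ∫ x, h x ∂(ν - μ) + ∫ x, h x ∂μ := by
    rw [← integral_add_measure (hν.mono_measure Measure.sub_le) (hν.mono_measure hle),
      Measure.sub_add_cancel_of_le hle]
  have hmass : ν.real Set.univ = (ν - μ).real Set.univ + μ.real Set.univ := by
    rw [← measureReal_add_apply, Measure.sub_add_cancel_of_le hle]
  rw [hint, hmass]
  linarith

end MeasureTheory

/-- the infimum over `μ₀ ≤ μ ⊓ ν` of the `β = 0` objective is attained
at `μ₀ = μ ⊓ ν`, with value `∫ min(‖f−g‖^p, 2 lam) d(μ∧ν) + lam ‖μ−ν‖_TV`. -/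
theorem ptlp_beta_zero_minimizer {d k : ℕ} (Ω : Set (EuclideanSpace ℝ (Fin d)))
    (hΩne : Ω.Nonempty) (hΩcl : IsClosed Ω)
    (p lam : ℝ) (hp : 1 ≤ p) (hlam : 0 < lam)
    (μ ν : Measure Ω) [IsFiniteMeasure μ] [IsFiniteMeasure ν]
    (f g : Ω → EuclideanSpace ℝ (Fin k)) (hf : Measurable f) (hg : Measurable g) :
    (∀ μ0 : Measure Ω, μ0 ≤ μ ⊓ ν →
        ((∫ x, min (‖f x - g x‖ ^ p) (2 * lam) ∂(μ ⊓ ν))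
            + lam * ((μ Set.univ).toReal + (ν Set.univ).toReal
              - 2 * ((μ ⊓ ν) Set.univ).toReal))
          ≤ ((∫ x, min (‖f x - g x‖ ^ p) (2 * lam) ∂μ0)
            + lam * ((μ Set.univ).toReal + (ν Set.univ).toReal
              - 2 * (μ0 Set.univ).toReal))) ∧
      ((∫ x, min (‖f x - g x‖ ^ p) (2 * lam) ∂(μ ⊓ ν))
          + lam * ((μ Set.univ).toReal + (ν Set.univ).toReal
            - 2 * ((μ ⊓ ν) Set.univ).toReal))
        = (∫ x, min (‖f x - g x‖ ^ p) (2 * lam) ∂(μ ⊓ ν)) + lam * tvDist μ ν := by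
  refine ⟨fun μ0 hμ0 => ?_, by rw [tvDist_eq_sub_two_mul_inf]⟩
  have : IsFiniteMeasure (μ ⊓ ν) := isFiniteMeasure_of_le μ inf_le_left
  have : IsFiniteMeasure μ0 := isFiniteMeasure_of_le _ hμ0
  have hint : Integrable (fun x => min (‖f x - g x‖ ^ p) (2 * lam)) (μ ⊓ ν) := by
    refine Integrable.of_bound (Measurable.aestronglyMeasurable (by fun_prop)) (2 * lam)
      (.of_forall fun x => ?_)
    rw [Real.norm_of_nonneg (by positivity)]
    exact min_le_right _ _
  have := integral_sub_mul_measureReal_univ_anti hint (fun x => min_le_right _ _) hμ0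
  simp only [← measureReal_def]
  linarith
end
end

section
/- Let Ω be a nonempty closed subset of ℝ^d, p ≥ 1, λ > 0, μ, ν finite positive Radon measures on Ω, and f, g : Ω → ℝ^k Borel measurable. Then OPT_λ(f_#μ, g_#ν) = inf_{γ ∈ Π≤(μ,ν)} [ ∫_{Ω×Ω} ‖f(x)−g(y)‖^p dγ(x,y) + λ(μ(Ω) + ν(Ω) − 2γ(Ω×Ω)) ], i.e. the optimal partial transport cost between the pushforward measures on ℝ^k with cost ‖·−·‖^p equals the partial transport problem on Ω×Ω with ground cost c(x,y) = ‖f(x)−g(y)‖^p. -/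
open MeasureTheory Filter Topology BoundedContinuousFunction
open scoped ENNReal

noncomputable section

open ProbabilityTheory

/-- Composition of a measure with a kernel is monotone in the measure. -/
theorem kernel_bind_mono {X Y : Type*} [MeasurableSpace X] [MeasurableSpace Y]
    (κ : Kernel X Y) {α β : Measure X} (h : α ≤ β) : α.bind κ ≤ β.bind κ := by
  refine Measure.le_iff.2 fun s hs => ?_
  rw [Measure.bind_apply hs κ.aemeasurable, Measure.bind_apply hs κ.aemeasurable]
  exact lintegral_mono' h le_rfl

/-- Disintegration of a finite measure along a measurable map: a Markov kernel that recovers `μ`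
from `f_#μ` and whose fibre measure at almost every `y` is concentrated on `f⁻¹(y)`. -/
theorem exists_markov_fibre_kernel {X Y : Type*} [MeasurableSpace X] [StandardBorelSpace X]
    [Nonempty X] [MeasurableSpace Y] [StandardBorelSpace Y] (μ : Measure X) [IsFiniteMeasure μ]
    {f : X → Y} (hf : Measurable f) :
    ∃ κ : Kernel Y X, IsMarkovKernel κ ∧ (μ.map f).bind κ = μ ∧
      ∀ᵐ y ∂μ.map f, (κ y).map f = Measure.dirac y := by
  have : Nonempty Y := ‹Nonempty X›.map f
  refine ⟨condDistrib id f μ, inferInstance, ?_, ?_⟩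
  · simpa using condDistrib_comp_map (μ := μ) hf.aemeasurable aemeasurable_id
  · filter_upwards [condDistrib_comp (μ := μ) f aemeasurable_id hf, condDistrib_self (μ := μ) f]
      with y h₁ h₂
    rw [Function.comp_id, h₂, Kernel.map_apply _ hf, Kernel.id_apply] at h₁
    exact h₁.symm

theorem map_mem_PiLe {X Y : Type*} [MeasurableSpace X] [MeasurableSpace Y] {μ ν : Measure X}
    {f g : X → Y} (hf : Measurable f) (hg : Measurable g) {γ : Measure (X × X)}
    (hγ : γ ∈ PiLe μ ν) : γ.map (Prod.map f g) ∈ PiLe (μ.map f) (ν.map g) := by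
  have h₁ := Measure.map_mono hγ.1 hf
  have h₂ := Measure.map_mono hγ.2 hg
  rw [Measure.map_map hf measurable_fst] at h₁
  rw [Measure.map_map hg measurable_snd] at h₂
  constructor
  · rwa [Measure.map_map measurable_fst (hf.prodMap hg)]
  · rwa [Measure.map_map measurable_snd (hf.prodMap hg)]

/-- Every partial plan between pushforward measures lifts to a partial plan between the original
measures. -/
theorem exists_mem_PiLe_map_eq {X Y : Type*} [MeasurableSpace X] [StandardBorelSpace X]
    [Nonempty X] [MeasurableSpace Y] [StandardBorelSpace Y] {μ ν : Measure X}
    [IsFiniteMeasure μ] [IsFiniteMeasure ν] {f g : X → Y} (hf : Measurable f) (hg : Measurable g)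
    {γ : Measure (Y × Y)} (hγ : γ ∈ PiLe (μ.map f) (ν.map g)) :
    ∃ γ' ∈ PiLe μ ν, γ'.map (Prod.map f g) = γ := by
  obtain ⟨κ, _, hκ, hκf⟩ := exists_markov_fibre_kernel μ hf
  obtain ⟨η, _, hη, hηg⟩ := exists_markov_fibre_kernel ν hg
  refine ⟨γ.bind (κ.parallelComp η), ⟨?_, ?_⟩, ?_⟩
  · calc (γ.bind (κ.parallelComp η)).map Prod.fst = (γ.map Prod.fst).bind κ := by
          ext s hs
          rw [Measure.map_apply measurable_fst hs,
            Measure.bind_apply (measurable_fst hs) (Kernel.aemeasurable _),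
            Measure.bind_apply hs κ.aemeasurable,
            lintegral_map (κ.measurable_coe hs) measurable_fst]
          refine lintegral_congr fun z => ?_
          rw [← Set.prod_univ, Kernel.parallelComp_apply_prod, measure_univ, mul_one]
      _ ≤ (μ.map f).bind κ := kernel_bind_mono κ hγ.1
      _ = μ := hκ
  · calc (γ.bind (κ.parallelComp η)).map Prod.snd = (γ.map Prod.snd).bind η := by
          ext s hs
          rw [Measure.map_apply measurable_snd hs,
            Measure.bind_apply (measurable_snd hs) (Kernel.aemeasurable _),
            Measure.bind_apply hs η.aemeasurable,
            lintegral_map (η.measurable_coe hs) measurable_snd]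
          refine lintegral_congr fun z => ?_
          rw [← Set.univ_prod, Kernel.parallelComp_apply_prod, measure_univ, one_mul]
      _ ≤ (ν.map g).bind η := kernel_bind_mono η hγ.2
      _ = ν := hη
  · have h₁ := ae_of_ae_map measurable_fst.aemeasurable (ae_mono hγ.1 hκf)
    have h₂ := ae_of_ae_map measurable_snd.aemeasurable (ae_mono hγ.2 hηg)
    rw [Measure.map_comp _ _ (hf.prodMap hg)]
    refine (Measure.bind_congr_right ?_).trans Measure.bind_dirac
    filter_upwards [h₁, h₂] with z hz₁ hz₂
    rw [Kernel.map_apply _ (hf.prodMap hg), Kernel.parallelComp_apply,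
      ← Measure.map_prod_map _ _ hf hg, hz₁, hz₂, Measure.dirac_prod_dirac]

theorem optObj_map {X Y : Type*} [MeasurableSpace X] [MeasurableSpace Y] {μ ν : Measure X}
    {f g : X → Y} (hf : Measurable f) (hg : Measurable g) {c : Y × Y → ℝ} (hc : Measurable c)
    (lam : ℝ) (γ : Measure (X × X)) :
    optObj c lam (μ.map f) (ν.map g) (γ.map (Prod.map f g))
      = optObj (fun z => c (Prod.map f g z)) lam μ ν γ := by
  have hfg := hf.prodMap hg
  simp only [optObj, Measure.map_apply hf MeasurableSet.univ,
    Measure.map_apply hg MeasurableSet.univ, Measure.map_apply hfg MeasurableSet.univ,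
    Set.preimage_univ, integral_map hfg.aemeasurable hc.aestronglyMeasurable]

/-- Optimal partial transport between pushforwards, for an arbitrary measurable cost, equals
optimal partial transport with the pulled back cost. -/
theorem OPTc_map_eq {X Y : Type*} [MeasurableSpace X] [StandardBorelSpace X]
    [Nonempty X] [MeasurableSpace Y] [StandardBorelSpace Y] (μ ν : Measure X)
    [IsFiniteMeasure μ] [IsFiniteMeasure ν] {f g : X → Y} (hf : Measurable f) (hg : Measurable g)
    {c : Y × Y → ℝ} (hc : Measurable c) (lam : ℝ) :
    OPTc c lam (μ.map f) (ν.map g) = OPTc (fun z => c (Prod.map f g z)) lam μ ν := by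
  unfold OPTc
  congr 1
  ext r
  constructor
  · rintro ⟨γ, hγ, rfl⟩
    obtain ⟨γ', hγ', rfl⟩ := exists_mem_PiLe_map_eq hf hg hγ
    exact ⟨γ', hγ', (optObj_map hf hg hc lam γ').symm⟩
  · rintro ⟨γ, hγ, rfl⟩
    exact ⟨_, map_mem_PiLe hf hg hγ, optObj_map hf hg hc lam γ⟩

/-- the optimal partial transport between the pushforwards `f_#μ, g_#ν`
on `ℝ^k` with cost `‖·−·‖^p` equals the partial transport problem on `Ω × Ω` with
ground cost `‖f(x) − g(y)‖^p`. -/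
theorem opt_pushforward_eq_ground {d k : ℕ} (Ω : Set (EuclideanSpace ℝ (Fin d)))
    (hΩne : Ω.Nonempty) (hΩcl : IsClosed Ω)
    (p lam : ℝ) (hp : 1 ≤ p) (hlam : 0 < lam)
    (μ ν : Measure Ω) [IsFiniteMeasure μ] [IsFiniteMeasure ν]
    (f g : Ω → EuclideanSpace ℝ (Fin k)) (hf : Measurable f) (hg : Measurable g) :
    OPTc (fun z : EuclideanSpace ℝ (Fin k) × EuclideanSpace ℝ (Fin k) => ‖z.1 - z.2‖ ^ p)
        lam (μ.map f) (ν.map g)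
      = OPTc (fun z : Ω × Ω => ‖f z.1 - g z.2‖ ^ p) lam μ ν := by
  have := hΩne.to_subtype
  have := hΩcl.measurableSet.standardBorel
  exact OPTc_map_eq μ ν hf hg
    (c := fun z : EuclideanSpace ℝ (Fin k) × EuclideanSpace ℝ (Fin k) => ‖z.1 - z.2‖ ^ p)
    (by fun_prop) lam
end
end
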